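/- arXiv:2009.06463 — 5 statements merged into one kernel-verified Lean document; each statement's English description precedes it below -/
import Mathlib

section
/- Let Δ ⊂ ℝⁿ be a convex body containing the origin in its interior, and let V ⊆ ℝⁿ be a full-dimensional closed convex cone. Let P : Δ → ℝ be continuous and positive on the interior of Δ, let J : Δ → ℝ be integrable, non-positive, with ∫_Δ J dμ < 0, and let K : Δ → ℝ be integrable with ∫_Δ K dμ = 0. Assume K + J ≤ 0 almost everywhere on Δ, and let b be the point determined by ∫_Δ (x − b)(K(x) + J(x)) dμ(x) = 0; assume b lies in the interior of Δ. If b ∈ −V^∨, where V^∨ = {y ∈ ℝⁿ : ⟨v, y⟩ ≥ 0 for all v ∈ V} is the dual cone of V, then for every continuous concave function f : Δ → ℝ that is smooth on the interior of Δ, whose gradient ∇f(x) lies in V for every interior point x, and for which x ↦ f(x)K(x) + ⟨∇f(x), x⟩ J(x) is integrable, one has ∫_Δ ( f(x) K(x) + ⟨∇f(x), x⟩ J(x) ) dμ(x) ≥ 0. -/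
open MeasureTheory RealInnerProductSpace

/-- A function concave on `s` lies below its tangent hyperplane at any point of `s` where it is
differentiable. -/
theorem ConcaveOn.le_add_of_hasFDerivAt {E : Type*} [NormedAddCommGroup E] [NormedSpace ℝ E]
    {s : Set E} {f : E → ℝ} {f' : E →L[ℝ] ℝ} {x y : E} (hf : ConcaveOn ℝ s f) (hx : x ∈ s)
    (hy : y ∈ s) (hf' : HasFDerivAt f f' x) : f y ≤ f x + f' (y - x) := by
  have hconc := hf.comp_affineMap (AffineMap.lineMap (k := ℝ) x y)
  have hderiv : HasDerivAt (f ∘ AffineMap.lineMap (k := ℝ) x y) (f' (y - x)) 0 :=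
    HasFDerivAt.comp_hasDerivAt (0 : ℝ) (by simpa using hf') AffineMap.hasDerivAt_lineMap
  have h := hconc.slope_le_of_hasDerivAt (by simpa using hx) (by simpa using hy) one_pos hderiv
  simp only [slope_def_field, Function.comp_apply, AffineMap.lineMap_apply_one,
    AffineMap.lineMap_apply_zero, sub_zero, div_one] at h
  linarith

/-- A function concave on `s` lies below its tangent hyperplane at any point of `s` where it is
differentiable, in terms of the gradient. -/
theorem ConcaveOn.le_add_inner_gradient {E : Type*} [NormedAddCommGroup E]
    [InnerProductSpace ℝ E] [CompleteSpace E] {s : Set E} {f : E → ℝ} {x y : E}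
    (hf : ConcaveOn ℝ s f) (hx : x ∈ s) (hy : y ∈ s) (hf' : DifferentiableAt ℝ f x) :
    f y ≤ f x + ⟪gradient f x, y - x⟫ := by
  simpa using hf.le_add_of_hasFDerivAt hx hy hf'.hasGradientAt.hasFDerivAt

/-- Proposition (sufficient condition for semi-stability).
Let `Δ ⊂ ℝⁿ` be a convex body containing `0` in its interior and `V` a full dimensional
closed convex cone.  Let `P` be continuous on `Δ` and positive on its interior, `J`
integrable non-positive with negative integral, `K` integrable with zero integral,
`K + J ≤ 0` a.e., and let `b` be the point with `∫_Δ (x − b)(K + J) dμ = 0`.  If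
`b ∈ −V^∨` then `∫_Δ (f(x) K(x) + ⟨∇f(x), x⟩ J(x)) dμ(x) ≥ 0` for every continuous
concave function `f` on `Δ`, smooth on the interior with gradients in `V`, for which the
integrand is integrable. -/
theorem semistability_sufficient_condition {n : ℕ}
    (Δ V : Set (EuclideanSpace ℝ (Fin n)))
    (hΔconv : Convex ℝ Δ) (hΔcomp : IsCompact Δ)
    (h0 : (0 : EuclideanSpace ℝ (Fin n)) ∈ interior Δ)
    (hVconv : Convex ℝ V) (hVclosed : IsClosed V)
    (hVcone : ∀ c : ℝ, 0 ≤ c → ∀ v ∈ V, c • v ∈ V)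
    (hVfull : (interior V).Nonempty)
    (P J K : EuclideanSpace ℝ (Fin n) → ℝ)
    (hPcont : ContinuousOn P Δ) (hPpos : ∀ x ∈ interior Δ, 0 < P x)
    (hJint : IntegrableOn J Δ) (hJnonpos : ∀ x ∈ Δ, J x ≤ 0)
    (hJneg : (∫ x in Δ, J x) < 0)
    (hKint : IntegrableOn K Δ) (hKzero : (∫ x in Δ, K x) = 0)
    (hKJ : ∀ᵐ x ∂(volume.restrict Δ), K x + J x ≤ 0)
    (b : EuclideanSpace ℝ (Fin n))
    (hb : (∫ x in Δ, (K x + J x) • (x - b)) = 0)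
    (hbΔ : b ∈ interior Δ)
    (hbdual : b ∈ -{y : EuclideanSpace ℝ (Fin n) | ∀ v ∈ V, 0 ≤ ⟪v, y⟫}) :
    ∀ f : EuclideanSpace ℝ (Fin n) → ℝ,
      ContinuousOn f Δ → ConcaveOn ℝ Δ f →
      ContDiffOn ℝ (⊤ : ℕ∞) f (interior Δ) →
      (∀ x ∈ interior Δ, gradient f x ∈ V) →
      IntegrableOn (fun x => f x * K x + ⟪gradient f x, x⟫ * J x) Δ →
      0 ≤ ∫ x in Δ, (f x * K x + ⟪gradient f x, x⟫ * J x) := by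
  intro f _ hfconc hfsmooth hfV hfint
  have hdiff : ∀ x ∈ interior Δ, DifferentiableAt ℝ f x := fun x hx =>
    (hfsmooth.contDiffAt (isOpen_interior.mem_nhds hx)).differentiableAt (by simp)
  have hsub : interior Δ ⊆ Δ := interior_subset
  have hKJint : IntegrableOn (fun x => K x + J x) Δ := hKint.add hJint
  have hmoment : IntegrableOn (fun x => (K x + J x) • (x - b)) Δ :=
    hKJint.smul_continuousOn (by fun_prop) hΔcomp
  have hlin : IntegrableOn (fun x => ⟪gradient f b, (K x + J x) • (x - b)⟫) Δ :=
    hmoment.const_inner _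
  have hfb : f b ≤ f 0 := by
    have h := hfconc.le_add_inner_gradient (hsub h0) (hsub hbΔ) (hdiff 0 h0)
    have hv : 0 ≤ ⟪gradient f 0, -b⟫ := hbdual _ (hfV 0 h0)
    rw [inner_neg_right] at hv
    rw [sub_zero] at h
    linarith
  have hsum : IntegrableOn
      (fun x => f b * (K x + J x) + ⟪gradient f b, (K x + J x) • (x - b)⟫) Δ :=
    (hKJint.const_mul _).add hlin
  have hint : ∫ x in Δ, (f b * (K x + J x) + ⟪gradient f b, (K x + J x) • (x - b)⟫ - f 0 * J x)
      = (f b - f 0) * ∫ x in Δ, J x := by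
    rw [integral_sub hsum (hJint.const_mul _),
      integral_add (hKJint.const_mul _) hlin, integral_const_mul, integral_const_mul,
      integral_inner hmoment, hb, integral_add hKint hJint, hKzero, inner_zero_right]
    ring
  have hae : ∀ᵐ x ∂(volume.restrict Δ), x ∈ interior Δ := by
    have hfr : ∀ᵐ x ∂(volume.restrict Δ), x ∉ frontier Δ :=
      ae_restrict_of_ae (measure_eq_zero_iff_ae_notMem.1 (hΔconv.addHaar_frontier volume))
    filter_upwards [hfr, ae_restrict_mem hΔcomp.measurableSet] with x hx hxΔ
    by_contra h
    exact hx ⟨subset_closure hxΔ, h⟩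
  calc 0 ≤ (f b - f 0) * ∫ x in Δ, J x :=
        mul_nonneg_of_nonpos_of_nonpos (sub_nonpos.2 hfb) hJneg.le
    _ = _ := hint.symm
    _ ≤ _ := by
      refine integral_mono_ae (hsum.sub (hJint.const_mul _)) hfint ?_
      filter_upwards [hae, hKJ] with x hx hKJx
      have h₁ := hfconc.le_add_inner_gradient (hsub hx) (hsub h0) (hdiff x hx)
      have h₂ := hfconc.le_add_inner_gradient (hsub hbΔ) (hsub hx) (hdiff b hbΔ)
      rw [zero_sub, inner_neg_right] at h₁
      simp only [real_inner_smul_right]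
      nlinarith [mul_le_mul_of_nonpos_right h₁ (hJnonpos x (hsub hx)),
        mul_le_mul_of_nonpos_right h₂ hKJx]
end

section
/- Let Δ ⊂ ℝⁿ be a convex body and let P : Δ → ℝ be continuous and positive on the interior of Δ. For d > 0 set Δ_d := {x ∈ Δ : dist(x, ∂Δ) ≥ d}. Then for every d > 0 with Δ_d nonempty there exists a constant κ = κ(d) > 0 such that: for every point x ∈ Δ_d, every non-positive concave function f on Δ with ∫_Δ (−f) P dμ finite, and every superdifferential l of f at x, one has ‖l‖ ≤ κ ∫_Δ (−f) P dμ. -/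
open MeasureTheory RealInnerProductSpace

/-- A preconnected set that meets both `s` and its complement meets the frontier of `s`. -/
theorem IsPreconnected.inter_frontier_nonempty {X : Type*} [TopologicalSpace X] {t s : Set X}
    (ht : IsPreconnected t) (hts : (t ∩ s).Nonempty) (hts' : (t ∩ sᶜ).Nonempty) :
    (t ∩ frontier s).Nonempty := by
  by_contra hfr
  have hcover : ∀ z ∈ t, z ∈ closure s → z ∈ interior s := fun z hz hzc => by
    by_contra hzi
    exact hfr ⟨z, hz, hzc, hzi⟩
  obtain ⟨x, hxt, hxs⟩ := hts
  obtain ⟨y, hyt, hys⟩ := hts'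
  obtain ⟨z, -, hzi, hzc⟩ := ht _ _ isOpen_interior isClosed_closure.isOpen_compl
    (fun z hz => (em (z ∈ closure s)).imp (hcover z hz) id)
    ⟨x, hxt, hcover x hxt (subset_closure hxs)⟩
    ⟨y, hyt, fun hyc => hys (interior_subset (hcover y hyt hyc))⟩
  exact hzc (subset_closure (interior_subset hzi))

/-- A ball around a point of `s` whose radius is at most the distance from the centre to the
frontier of `s` is contained in `s`. -/
theorem ball_subset_of_le_infDist_frontier {E : Type*} [NormedAddCommGroup E] [NormedSpace ℝ E]
    {s : Set E} {x : E} {r : ℝ} (hx : x ∈ s) (hr : r ≤ Metric.infDist x (frontier s)) :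
    Metric.ball x r ⊆ s := by
  intro y hy
  by_contra hys
  have hr0 : 0 < r := Metric.pos_of_mem_ball hy
  obtain ⟨z, hzb, hzf⟩ := (convex_ball x r).isPreconnected.inter_frontier_nonempty
    ⟨x, Metric.mem_ball_self hr0, hx⟩ ⟨y, hy, hys⟩
  have := Metric.infDist_le_dist_of_mem (x := x) hzf
  rw [Metric.mem_ball, dist_comm] at hzb
  linarith

/-- Lemma (superdifferential bound).  Let `Δ ⊂ ℝⁿ` be a convex body and `P` continuous on
`Δ` and positive on its interior.  For `d > 0` with `Δ_d = {x ∈ Δ : dist(x, ∂Δ) ≥ d}`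
nonempty there is `κ = κ(d) > 0` such that for every `x ∈ Δ_d`, every non-positive concave
function `f` on `Δ` with `∫_Δ (−f) P dμ` finite, and every superdifferential `l` of `f`
at `x`, one has `‖l‖ ≤ κ ∫_Δ (−f) P dμ`. -/
theorem superdifferential_bound {n : ℕ}
    (Δ : Set (EuclideanSpace ℝ (Fin n)))
    (hΔconv : Convex ℝ Δ) (hΔcomp : IsCompact Δ) (hΔint : (interior Δ).Nonempty)
    (P : EuclideanSpace ℝ (Fin n) → ℝ)
    (hPcont : ContinuousOn P Δ) (hPpos : ∀ x ∈ interior Δ, 0 < P x)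
    (d : ℝ) (hd : 0 < d)
    (hne : {x ∈ Δ | d ≤ Metric.infDist x (frontier Δ)}.Nonempty) :
    ∃ κ > (0 : ℝ), ∀ x ∈ {x ∈ Δ | d ≤ Metric.infDist x (frontier Δ)},
      ∀ f : EuclideanSpace ℝ (Fin n) → ℝ,
        ConcaveOn ℝ Δ f → (∀ y ∈ Δ, f y ≤ 0) →
        IntegrableOn (fun y => (-f y) * P y) Δ →
        ∀ l : EuclideanSpace ℝ (Fin n),
          (∀ y ∈ Δ, f y ≤ f x + ⟪l, y - x⟫) →
          ‖l‖ ≤ κ * ∫ y in Δ, (-f y) * P y := by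
  have hcl : IsClosed Δ := hΔcomp.isClosed
  have hPnonneg : ∀ y ∈ Δ, 0 ≤ P y := by
    have hΔ : closure (interior Δ) = Δ := by
      rw [hΔconv.closure_interior_eq_closure_of_nonempty_interior hΔint, hcl.closure_eq]
    have hmaps : Set.MapsTo P (interior Δ) (Set.Ici 0) := fun y hy => (hPpos y hy).le
    have := hmaps.closure_of_continuousOn (by rwa [hΔ])
    rwa [hΔ, isClosed_Ici.closure_eq] at this
  obtain ⟨m, hm, hPm⟩ : ∃ m > (0 : ℝ),
      ∀ y ∈ Δ, d / 4 ≤ Metric.infDist y (frontier Δ) → m ≤ P y := by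
    have hK : IsCompact (Δ ∩ {y | d / 4 ≤ Metric.infDist y (frontier Δ)}) :=
      hΔcomp.inter_right (isClosed_le continuous_const (Metric.continuous_infDist_pt _))
    obtain ⟨x₀, hx₀, hx₀d⟩ := hne
    obtain ⟨z, ⟨hzΔ, hzd⟩, hz⟩ := hK.exists_isMinOn
      ⟨x₀, hx₀, (by linarith : d / 4 ≤ d).trans hx₀d⟩ (hPcont.mono Set.inter_subset_left)
    refine ⟨P z, hPpos z ?_, fun y hy hyd => hz ⟨hy, hyd⟩⟩
    by_contra hzi
    have hzf : z ∈ frontier Δ := ⟨subset_closure hzΔ, hzi⟩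
    have hz0 := Metric.infDist_zero_of_mem hzf
    rw [Set.mem_ofPred_eq, hz0] at hzd
    linarith
  set V := volume.real (Metric.ball (0 : EuclideanSpace ℝ (Fin n)) (d / 4)) with hV
  have hVpos : 0 < V :=
    ENNReal.toReal_pos (Metric.measure_ball_pos _ _ (by positivity)).ne' measure_ball_lt_top.ne
  refine ⟨(d / 4 * m * V)⁻¹, by positivity, ?_⟩
  rintro x ⟨hxΔ, hxd⟩ f - hf hint l hl
  rcases eq_or_ne l 0 with rfl | hl0
  · rw [norm_zero]
    exact mul_nonneg (by positivity) (setIntegral_nonneg hcl.measurableSet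
      fun y hy => mul_nonneg (neg_nonneg.2 (hf y hy)) (hPnonneg y hy))
  have hlpos : 0 < ‖l‖ := norm_pos_iff.2 hl0
  set c := x - (d / 2 * ‖l‖⁻¹) • l with hc
  have hcx : dist c x = d / 2 := by
    rw [hc, dist_eq_norm, sub_sub_cancel_left, norm_neg, norm_smul, Real.norm_eq_abs,
      abs_of_pos (by positivity)]
    field_simp
  have hyx : ∀ y ∈ Metric.ball c (d / 4), dist y x < 3 * d / 4 := fun y hy => by
    have := dist_triangle y c x
    rw [Metric.mem_ball] at hy
    linarith
  have hBΔ : Metric.ball c (d / 4) ⊆ Δ := fun y hy =>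
    ball_subset_of_le_infDist_frontier hxΔ hxd (by
      rw [Metric.mem_ball]; linarith [hyx y hy])
  have hBP : ∀ y ∈ Metric.ball c (d / 4), m ≤ P y := fun y hy => by
    refine hPm y (hBΔ hy) ?_
    have h := Metric.infDist_le_infDist_add_dist (s := frontier Δ) (x := x) (y := y)
    rw [dist_comm] at h
    linarith [hyx y hy]
  have hBf : ∀ y ∈ Metric.ball c (d / 4), ‖l‖ * (d / 4) ≤ -f y := fun y hy => by
    have hsplit : ⟪l, y - x⟫ = ⟪l, y - c⟫ - d / 2 * ‖l‖ := by
      have : y - x = (y - c) - (d / 2 * ‖l‖⁻¹) • l := by rw [hc]; abel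
      rw [this, inner_sub_right, inner_smul_right, real_inner_self_eq_norm_sq]
      field_simp
    have hyc : ⟪l, y - c⟫ ≤ ‖l‖ * (d / 4) :=
      (real_inner_le_norm _ _).trans (mul_le_mul_of_nonneg_left
        (by rw [← dist_eq_norm]; exact (Metric.mem_ball.1 hy).le) hlpos.le)
    linarith [hl y (hBΔ hy), hf x hxΔ]
  have hVc : volume.real (Metric.ball c (d / 4)) = V := by
    rw [hV, measureReal_def, measureReal_def, Measure.addHaar_ball_center]
  have hlower : ‖l‖ * (d / 4) * m * V ≤ ∫ y in Δ, (-f y) * P y :=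
    calc ‖l‖ * (d / 4) * m * V = ∫ _ in Metric.ball c (d / 4), ‖l‖ * (d / 4) * m := by
          rw [setIntegral_const, hVc, smul_eq_mul, mul_comm]
      _ ≤ ∫ y in Metric.ball c (d / 4), (-f y) * P y :=
          setIntegral_mono_on (integrableOn_const measure_ball_lt_top.ne) (hint.mono_set hBΔ)
            measurableSet_ball fun y hy => mul_le_mul (hBf y hy) (hBP y hy) hm.le
              ((by positivity : 0 ≤ ‖l‖ * (d / 4)).trans (hBf y hy))
      _ ≤ ∫ y in Δ, (-f y) * P y :=
          setIntegral_mono_set hint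
            ((ae_restrict_iff' hcl.measurableSet).2 (.of_forall fun y hy =>
              mul_nonneg (neg_nonneg.2 (hf y hy)) (hPnonneg y hy)))
            hBΔ.eventuallyLE
  rw [inv_mul_eq_div, le_div_iff₀ (by positivity)]
  linarith
end

section
/- Let Δ ⊂ ℝⁿ be a convex body, let P : Δ → ℝ be continuous and positive on the interior of Δ, and let C be a positive real number. Then any sequence (f_m) of non-positive concave functions on Δ with ∫_Δ (−f_m) P dμ ≤ C for all m has a subsequence which converges on the interior of Δ to a concave function f_∞, and the convergence is uniform on every compact subset of the interior of Δ. -/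
open MeasureTheory

open Filter Topology Metric

/-- Sub-mean value property of a concave function on a ball. -/
theorem ConcaveOn.setIntegral_closedBall_le {E : Type*} [NormedAddCommGroup E] [NormedSpace ℝ E]
    [FiniteDimensional ℝ E] [MeasurableSpace E] [BorelSpace E] (μ : Measure E)
    [μ.IsAddHaarMeasure] {g : E → ℝ} {y : E} {r : ℝ}
    (hg : ConcaveOn ℝ (closedBall y r) g) (hgi : IntegrableOn g (closedBall y r) μ) :
    ∫ x in closedBall y r, g x ∂μ ≤ μ.real (closedBall y r) * g y := by
  have hmp : MeasurePreserving (fun x => (y + y) - x) μ μ :=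
    μ.measurePreserving_sub_left (y + y)
  have hemb : MeasurableEmbedding (fun x : E => (y + y) - x) :=
    (Homeomorph.subLeft (y + y)).measurableEmbedding
  have hdist (x : E) : dist (y + y - x) y = dist x y := by
    rw [dist_eq_norm, dist_eq_norm, ← norm_neg]
    congr 1
    abel
  have hpre : (fun x => (y + y) - x) ⁻¹' closedBall y r = closedBall y r := by
    ext x
    simp [hdist]
  have hrefl : ∫ x in closedBall y r, g (y + y - x) ∂μ = ∫ x in closedBall y r, g x ∂μ := by
    have h := hmp.setIntegral_preimage_emb hemb g (closedBall y r)
    rwa [hpre] at h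
  have hrefli : IntegrableOn (fun x => g (y + y - x)) (closedBall y r) μ := by
    have h := (hmp.integrableOn_comp_preimage hemb (f := g) (s := closedBall y r)).2 hgi
    rwa [hpre] at h
  have hmid : ∀ x ∈ closedBall y r, g x + g (y + y - x) ≤ 2 * g y := by
    intro x hx
    have hx' : y + y - x ∈ closedBall y r := by
      rw [mem_closedBall, hdist]
      exact hx
    have h := hg.2 hx hx' (by norm_num : (0 : ℝ) ≤ 1 / 2) (by norm_num : (0 : ℝ) ≤ 1 / 2)
      (by norm_num)
    have hy : (1 / 2 : ℝ) • x + (1 / 2 : ℝ) • (y + y - x) = y := by module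
    rw [hy] at h
    simp only [smul_eq_mul] at h
    linarith
  have hfin : μ (closedBall y r) ≠ ⊤ := measure_closedBall_lt_top.ne
  have h := setIntegral_mono_on (hgi.add hrefli) (integrableOn_const hfin)
    measurableSet_closedBall hmid
  simp only [Pi.add_apply] at h
  rw [integral_add hgi hrefli, hrefl, setIntegral_const, smul_eq_mul] at h
  linarith

/-- A sequence in `C(X, ℝ)` which is equicontinuous and pointwise bounded has a subsequence
converging uniformly on compact sets. -/
theorem ContinuousMap.exists_tendsto_subseq_of_equicontinuous {X : Type*} [TopologicalSpace X]
    [LocallyCompactSpace X] [SigmaCompactSpace X] (F : ℕ → C(X, ℝ))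
    (heq : Equicontinuous fun m x => F m x) (hbdd : ∀ x, ∃ M, ∀ m, |F m x| ≤ M) :
    ∃ (φ : ℕ → ℕ) (G : C(X, ℝ)), StrictMono φ ∧ Tendsto (F ∘ φ) atTop (𝓝 G) := by
  have : T2Space (UniformOnFun X ℝ {K : Set X | IsCompact K}) :=
    UniformOnFun.t2Space_of_covering <| Set.eq_univ_of_forall fun x =>
      Set.mem_sUnion_of_mem (Set.mem_singleton x) isCompact_singleton
  have hcpt : IsCompact (closure (Set.range F)) := by
    refine ArzelaAscoli.isCompact_closure_of_isClosedEmbedding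
      (𝔖 := {K : Set X | IsCompact K}) (F := fun f : C(X, ℝ) => (f : X → ℝ)) (fun K hK => hK)
      ContinuousMap.isUniformEmbedding_toUniformOnFunIsCompact.isClosedEmbedding ?_ ?_
    · intro K _
      refine Equicontinuous.equicontinuousOn ?_ K
      intro x U hU
      filter_upwards [heq x U hU] with z hz
      rintro ⟨_, m, rfl⟩
      exact hz m
    · intro K _ x _
      obtain ⟨M, hM⟩ := hbdd x
      refine ⟨Set.Icc (-M) M, isCompact_Icc, ?_⟩
      rintro _ ⟨m, rfl⟩
      exact abs_le.1 (hM m)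
  obtain ⟨G, _, φ, hφ, hG⟩ := hcpt.tendsto_subseq fun m => subset_closure (Set.mem_range_self m)
  exact ⟨φ, G, hφ, hG⟩

/-- A pointwise limit of concave functions is concave. -/
theorem ConcaveOn.of_tendsto {E : Type*} [AddCommGroup E] [Module ℝ E] {s : Set E}
    {g : ℕ → E → ℝ} {G : E → ℝ} (hs : Convex ℝ s) (hg : ∀ m, ConcaveOn ℝ s (g m))
    (h : ∀ x ∈ s, Tendsto (fun m => g m x) atTop (𝓝 (G x))) : ConcaveOn ℝ s G := by
  refine ⟨hs, fun x hx y hy a b ha hb hab => ?_⟩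
  exact le_of_tendsto_of_tendsto' (((h x hx).const_smul a).add ((h y hy).const_smul b))
    (h _ (hs hx hy ha hb hab)) fun m => (hg m).2 hx hy ha hb hab

/-- A locally uniformly bounded sequence of concave functions on an open convex set has a
subsequence converging uniformly on compact subsets to a concave function. -/
theorem ConcaveOn.exists_subseq_tendstoUniformlyOn {E : Type*} [NormedAddCommGroup E]
    [NormedSpace ℝ E] [FiniteDimensional ℝ E] {U : Set E} (hUo : IsOpen U) (hU : Convex ℝ U)
    {g : ℕ → E → ℝ} (hg : ∀ m, ConcaveOn ℝ U (g m))
    (hbdd : ∀ x ∈ U, ∃ r > 0, ball x r ⊆ U ∧ ∃ M, ∀ m, ∀ y ∈ ball x r, |g m y| ≤ M) :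
    ∃ φ : ℕ → ℕ, StrictMono φ ∧ ∃ G : E → ℝ, ConcaveOn ℝ U G ∧
      (∀ x ∈ U, Tendsto (fun m => g (φ m) x) atTop (𝓝 (G x))) ∧
      ∀ S ⊆ U, IsCompact S → TendstoUniformlyOn (fun m => g (φ m)) G atTop S := by
  have : ProperSpace E := FiniteDimensional.proper_real E
  have : LocallyCompactSpace U := hUo.locallyCompactSpace
  have hcont (m : ℕ) : ContinuousOn (g m) U := (hg m).continuousOn hUo
  let F : ℕ → C(U, ℝ) := fun m => ⟨U.domRestrict (g m), (hcont m).domRestrict⟩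
  have heq : Equicontinuous fun m x => F m x := by
    rintro ⟨x, hx⟩
    obtain ⟨r, hr, hrU, M, hM⟩ := hbdd x hx
    have hlip (m : ℕ) := ((hg m).subset hrU (convex_ball x r)).lipschitzOnWith_of_abs_le
      (half_pos hr) (hM m)
    have hx' : ball x (r - r / 2) ∈ 𝓝 x := ball_mem_nhds x (by linarith)
    have h := (LipschitzOnWith.uniformEquicontinuousOn g _ hlip).equicontinuousOn x
      (mem_of_mem_nhds hx')
    intro V hV
    have h' := h V hV
    rw [nhdsWithin_eq_nhds.2 hx'] at h'
    exact (continuous_subtype_val.tendsto (⟨x, hx⟩ : U)).eventually h'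
  have hpt : ∀ x, ∃ M, ∀ m, |F m x| ≤ M := by
    rintro ⟨x, hx⟩
    obtain ⟨r, hr, _, M, hM⟩ := hbdd x hx
    exact ⟨M, fun m => hM m x (mem_ball_self hr)⟩
  obtain ⟨φ, G, hφ, hG⟩ := ContinuousMap.exists_tendsto_subseq_of_equicontinuous F heq hpt
  rw [ContinuousMap.tendsto_iff_forall_isCompact_tendstoUniformlyOn] at hG
  let H : E → ℝ := Function.extend Subtype.val G 0
  have hH (x : U) : H x = G x := Subtype.val_injective.extend_apply _ _ x
  have hunif : ∀ S ⊆ U, IsCompact S → TendstoUniformlyOn (fun m => g (φ m)) H atTop S := by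
    intro S hSU hS
    have hK : IsCompact (Subtype.val ⁻¹' S : Set U) :=
      IsInducing.subtypeVal.isCompact_preimage' hS (by simpa using hSU)
    intro V hV
    filter_upwards [hG _ hK V hV] with m hm x hxS
    have h := hm ⟨x, hSU hxS⟩ hxS
    rw [← hH] at h
    exact h
  have hlim : ∀ x ∈ U, Tendsto (fun m => g (φ m) x) atTop (𝓝 (H x)) := fun x hx =>
    (hunif {x} (Set.singleton_subset_iff.2 hx) isCompact_singleton).tendsto_at rfl
  exact ⟨φ, hφ, H, .of_tendsto hU (fun m => hg (φ m)) hlim, hlim, hunif⟩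

/-- Proposition (pre-compactness).  Let `Δ ⊂ ℝⁿ` be a convex body, `P` continuous on `Δ`
and positive on its interior, and `C > 0`.  Any sequence `(f_m)` of non-positive concave
functions on `Δ` with `∫_Δ (−f_m) P dμ ≤ C` has a subsequence converging on the interior
of `Δ` to a concave function `f_∞`, uniformly on every compact subset of the interior. -/
theorem precompactness_of_bounded_concave_sequences {n : ℕ}
    (Δ : Set (EuclideanSpace ℝ (Fin n)))
    (hΔconv : Convex ℝ Δ) (hΔcomp : IsCompact Δ) (hΔint : (interior Δ).Nonempty)
    (P : EuclideanSpace ℝ (Fin n) → ℝ)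
    (hPcont : ContinuousOn P Δ) (hPpos : ∀ x ∈ interior Δ, 0 < P x)
    (C : ℝ) (hC : 0 < C)
    (f : ℕ → EuclideanSpace ℝ (Fin n) → ℝ)
    (hconc : ∀ m, ConcaveOn ℝ Δ (f m))
    (hnonpos : ∀ m, ∀ x ∈ Δ, f m x ≤ 0)
    (hint : ∀ m, IntegrableOn (fun x => (-(f m x)) * P x) Δ)
    (hbound : ∀ m, (∫ x in Δ, (-(f m x)) * P x) ≤ C) :
    ∃ φ : ℕ → ℕ, StrictMono φ ∧
      ∃ flim : EuclideanSpace ℝ (Fin n) → ℝ,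
        ConcaveOn ℝ (interior Δ) flim ∧
        (∀ x ∈ interior Δ,
          Filter.Tendsto (fun m => f (φ m) x) Filter.atTop (nhds (flim x))) ∧
        ∀ S : Set (EuclideanSpace ℝ (Fin n)), S ⊆ interior Δ → IsCompact S →
          TendstoUniformlyOn (fun m => f (φ m)) flim Filter.atTop S := by
  have hPnonneg : ∀ x ∈ Δ, 0 ≤ P x := by
    intro x hx
    have hx' : x ∈ closure (interior Δ) := by
      rw [hΔconv.closure_interior_eq_closure_of_nonempty_interior hΔint]
      exact subset_closure hx
    have := mem_closure_iff_nhdsWithin_neBot.1 hx'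
    exact ge_of_tendsto ((hPcont x hx).mono interior_subset)
      (eventually_mem_nhdsWithin.mono fun z hz => (hPpos z hz).le)
  refine ConcaveOn.exists_subseq_tendstoUniformlyOn isOpen_interior hΔconv.interior
    (fun m => (hconc m).subset interior_subset hΔconv.interior) fun x hx => ?_
  obtain ⟨R, hR, hRΔ⟩ := nhds_basis_closedBall.mem_iff.1 (isOpen_interior.mem_nhds hx)
  obtain ⟨z, hz, hzmin⟩ := (isCompact_closedBall x R).exists_isMinOn
    ⟨x, mem_closedBall_self hR.le⟩ (hPcont.mono (hRΔ.trans interior_subset))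
  have hPz : 0 < P z := hPpos z (hRΔ hz)
  have hr : 0 < R / 2 := half_pos hR
  set V := volume.real (closedBall (0 : EuclideanSpace ℝ (Fin n)) (R / 2)) with hV
  have hVpos : 0 < V :=
    ENNReal.toReal_pos (measure_closedBall_pos _ _ hr).ne' measure_closedBall_lt_top.ne
  refine ⟨R / 2, hr, ((ball_subset_ball (by linarith)).trans ball_subset_closedBall).trans hRΔ,
    C / (V * P z), fun m y hy => ?_⟩
  have hBR : closedBall y (R / 2) ⊆ closedBall x R :=
    closedBall_subset_closedBall' (by linarith [mem_ball.1 hy])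
  have hBint : closedBall y (R / 2) ⊆ interior Δ := hBR.trans hRΔ
  have hBΔ : closedBall y (R / 2) ⊆ Δ := hBint.trans interior_subset
  have hfi : IntegrableOn (f m) (closedBall y (R / 2)) :=
    ((hconc m).continuousOn_interior.mono hBint).integrableOn_compact (isCompact_closedBall _ _)
  have hmean := ((hconc m).subset hBΔ (convex_closedBall _ _)).setIntegral_closedBall_le volume hfi
  have hvol : volume.real (closedBall y (R / 2)) = V := by
    rw [hV, measureReal_def, measureReal_def, Measure.addHaar_closedBall_center]
  rw [hvol] at hmean
  have hweight : P z * ∫ w in closedBall y (R / 2), -(f m w) ≤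
      ∫ w in closedBall y (R / 2), -(f m w) * P w := by
    rw [← integral_const_mul]
    refine setIntegral_mono_on (hfi.neg.const_mul _) ((hint m).mono_set hBΔ)
      measurableSet_closedBall fun w hw => ?_
    rw [mul_comm]
    exact mul_le_mul_of_nonneg_left (hzmin (hBR hw)) (neg_nonneg.2 (hnonpos m w (hBΔ hw)))
  have hmono : ∫ w in closedBall y (R / 2), -(f m w) * P w ≤ ∫ w in Δ, -(f m w) * P w := by
    refine setIntegral_mono_set (hint m) ?_ hBΔ.eventuallyLE
    filter_upwards [ae_restrict_mem hΔcomp.measurableSet] with w hw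
    exact mul_nonneg (neg_nonneg.2 (hnonpos m w hw)) (hPnonneg w hw)
  rw [integral_neg] at hweight
  have hy0 : f m y ≤ 0 := hnonpos m y (hBΔ (mem_closedBall_self hr.le))
  rw [abs_of_nonpos hy0, le_div_iff₀ (mul_pos hVpos hPz)]
  have := hbound m
  nlinarith [mul_le_mul_of_nonneg_left hmean hPz.le]
end

section
/- Let Δ ⊂ ℝⁿ be a convex body and let P : Δ → ℝ be continuous and positive on the interior of Δ. For d > 0 set Δ_d := {x ∈ Δ : dist(x, ∂Δ) ≥ d}. Then for every d > 0 with Δ_d nonempty there exists a constant C_d > 0 such that every non-positive concave function f on Δ with ∫_Δ (−f) P dμ finite satisfies: (i) 0 ≥ f(x) ≥ −C_d ∫_Δ (−f) P dμ for all x ∈ Δ_d, and (ii) |f(x) − f(y)| ≤ C_d (∫_Δ (−f) P dμ) · ‖x − y‖ for all x, y ∈ Δ_d. In other words, a bound on ∫_Δ (−f) P dμ provides a uniform bound and a Lipschitz bound for f on each set Δ_d. -/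
open MeasureTheory

open Metric in
/-- Moving a distance less than `d` away from a point of a closed set whose distance to the frontier
is at least `d` does not leave the interior of the set. -/
lemma IsClosed.ball_subset_interior_of_le_infDist_frontier {E : Type*} [NormedAddCommGroup E]
    [NormedSpace ℝ E] {s : Set E} (hs : IsClosed s) {x : E} (hx : x ∈ s) {d : ℝ}
    (hd : d ≤ infDist x (frontier s)) : ball x d ⊆ interior s := by
  rcases le_or_gt d 0 with hd0 | hd0
  · simp [ball_eq_empty.2 hd0]
  have hdisj : ∀ y ∈ ball x d, y ∉ frontier s := fun y hy =>
    notMem_of_dist_lt_infDist ((mem_ball'.1 hy).trans_le hd)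
  refine (convex_ball x d).isPreconnected.subset_left_of_subset_union isOpen_interior
    hs.isOpen_compl (disjoint_compl_right.mono_left interior_subset) (fun y hy => ?_) ?_
  · have h := hdisj y hy
    rw [hs.frontier_eq] at h
    by_cases hys : y ∈ s
    · exact Or.inl (by_contra fun hyi => h ⟨hys, hyi⟩)
    · exact Or.inr hys
  · have hxd := mem_ball_self (x := x) hd0
    have h := hdisj x hxd
    rw [hs.frontier_eq] at h
    exact ⟨x, hxd, by_contra fun hxi => h ⟨hx, hxi⟩⟩

open Metric in
/-- A closed ball of radius `r` around a point of a closed set at distance at least `d > r` from the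
frontier consists of points of the set at distance at least `d - r` from the frontier. -/
lemma IsClosed.mem_and_le_infDist_frontier_of_mem_closedBall {E : Type*} [NormedAddCommGroup E]
    [NormedSpace ℝ E] {s : Set E} (hs : IsClosed s) {x y : E} {d r : ℝ}
    (hx : x ∈ {x ∈ s | d ≤ infDist x (frontier s)}) (hr : r < d) (hy : y ∈ closedBall x r) :
    y ∈ {x ∈ s | d - r ≤ infDist x (frontier s)} := by
  refine ⟨interior_subset (hs.ball_subset_interior_of_le_infDist_frontier hx.1 hx.2
    (closedBall_subset_ball hr hy)), ?_⟩
  have h := infDist_le_infDist_add_dist (s := frontier s) (x := x) (y := y)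
  have hyx := mem_closedBall'.1 hy
  have hxd := hx.2
  linarith

open Metric in
/-- The value of a convex function at the centre of a ball is at most its average over the ball. -/
lemma ConvexOn.measureReal_closedBall_mul_le_setIntegral {E : Type*} [NormedAddCommGroup E]
    [NormedSpace ℝ E] [FiniteDimensional ℝ E] [MeasurableSpace E] [BorelSpace E]
    {μ : Measure E} [μ.IsAddHaarMeasure] {g : E → ℝ} {x : E} {r : ℝ}
    (hg : ConvexOn ℝ (closedBall x r) g) (hgi : IntegrableOn g (closedBall x r) μ) :
    μ.real (closedBall x r) * g x ≤ ∫ y in closedBall x r, g y ∂μ := by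
  have hpre : (fun y => (x + x) - y) ⁻¹' closedBall x r = closedBall x r := by
    ext y
    simp only [Set.mem_preimage, mem_closedBall, dist_eq_norm]
    rw [← norm_neg (y - x)]
    congr! 2
    abel
  have hmp : MeasurePreserving (fun y => (x + x) - y) μ μ := μ.measurePreserving_sub_left (x + x)
  have hme : MeasurableEmbedding (fun y => (x + x) - y) :=
    (MeasurableEquiv.subLeft (x + x)).measurableEmbedding
  have hint : ∫ y in closedBall x r, g ((x + x) - y) ∂μ = ∫ y in closedBall x r, g y ∂μ := by
    simpa only [hpre] using hmp.setIntegral_preimage_emb hme g (closedBall x r)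
  have hgi' : IntegrableOn (fun y => g ((x + x) - y)) (closedBall x r) μ := by
    have h := (hmp.integrableOn_comp_preimage hme (f := g) (s := closedBall x r)).2 hgi
    rwa [hpre] at h
  have hmono : ∫ _ in closedBall x r, 2 * g x ∂μ
      ≤ ∫ y in closedBall x r, (g y + g ((x + x) - y)) ∂μ := by
    refine setIntegral_mono_on (integrableOn_const measure_closedBall_lt_top.ne)
      (hgi.add hgi') measurableSet_closedBall fun y hy => ?_
    have hy' : (x + x) - y ∈ closedBall x r := by
      rw [← hpre] at hy
      exact hy
    have h := hg.2 hy hy' one_half_pos.le one_half_pos.le (add_halves (1 : ℝ))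
    have hmid : (1 / 2 : ℝ) • y + (1 / 2 : ℝ) • ((x + x) - y) = x := by module
    rw [hmid, smul_eq_mul, smul_eq_mul] at h
    linarith
  rw [integral_add hgi hgi', hint, setIntegral_const, smul_eq_mul] at hmono
  linarith

open Metric in
/-- If a nonnegative convex function `g` is integrable against a nonnegative weight `P` on `s`, and
`P` is at least `m` on a ball inside the interior of `s`, then the weighted integral controls the
value of `g` at the centre of that ball. -/
lemma ConvexOn.mul_measureReal_closedBall_mul_le_setIntegral_mul {E : Type*}
    [NormedAddCommGroup E] [NormedSpace ℝ E] [FiniteDimensional ℝ E] [MeasurableSpace E]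
    [BorelSpace E] {μ : Measure E} [μ.IsAddHaarMeasure] {s : Set E} (hs : MeasurableSet s)
    {g P : E → ℝ} (hg : ConvexOn ℝ s g) (hg0 : ∀ y ∈ s, 0 ≤ g y) (hP0 : ∀ y ∈ s, 0 ≤ P y)
    (hgP : IntegrableOn (fun y => g y * P y) s μ) {x : E} {r m : ℝ} (hm : 0 ≤ m)
    (hball : closedBall x r ⊆ interior s) (hP : ∀ y ∈ closedBall x r, m ≤ P y) :
    m * μ.real (closedBall x r) * g x ≤ ∫ y in s, g y * P y ∂μ := by
  have hballs : closedBall x r ⊆ s := hball.trans interior_subset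
  have hgi : IntegrableOn g (closedBall x r) μ :=
    (hg.continuousOn_interior.mono hball).integrableOn_compact (isCompact_closedBall x r)
  have havg := (hg.subset hballs (convex_closedBall x r)).measureReal_closedBall_mul_le_setIntegral
    hgi
  calc m * μ.real (closedBall x r) * g x
      = m * (μ.real (closedBall x r) * g x) := mul_assoc _ _ _
    _ ≤ m * ∫ y in closedBall x r, g y ∂μ := mul_le_mul_of_nonneg_left havg hm
    _ = ∫ y in closedBall x r, m * g y ∂μ := (integral_const_mul _ _).symm
    _ ≤ ∫ y in closedBall x r, g y * P y ∂μ := by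
      refine setIntegral_mono_on (hgi.const_mul m) (hgP.mono_set hballs)
        measurableSet_closedBall fun y hy => ?_
      rw [mul_comm]
      exact mul_le_mul_of_nonneg_left (hP y hy) (hg0 y (hballs hy))
    _ ≤ ∫ y in s, g y * P y ∂μ := by
      refine setIntegral_mono_set hgP ?_ hballs.eventuallyLE
      filter_upwards [ae_restrict_mem hs] with y hy
      exact mul_nonneg (hg0 y hy) (hP0 y hy)

/-- Uniform and Lipschitz bounds on interior compact slices.  Let `Δ ⊂ ℝⁿ` be a convex
body and `P` continuous on `Δ`, positive on its interior.  For `d > 0` with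
`Δ_d = {x ∈ Δ : dist(x, ∂Δ) ≥ d}` nonempty, there is `C_d > 0` such that every
non-positive concave function `f` on `Δ` with `∫_Δ (−f) P dμ` finite satisfies
`0 ≥ f(x) ≥ −C_d ∫_Δ (−f) P dμ` on `Δ_d` and
`|f(x) − f(y)| ≤ C_d (∫_Δ (−f) P dμ) ‖x − y‖` for `x, y ∈ Δ_d`. -/
theorem uniform_and_lipschitz_bound {n : ℕ}
    (Δ : Set (EuclideanSpace ℝ (Fin n)))
    (hΔconv : Convex ℝ Δ) (hΔcomp : IsCompact Δ) (hΔint : (interior Δ).Nonempty)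
    (P : EuclideanSpace ℝ (Fin n) → ℝ)
    (hPcont : ContinuousOn P Δ) (hPpos : ∀ x ∈ interior Δ, 0 < P x)
    (d : ℝ) (hd : 0 < d)
    (hne : {x ∈ Δ | d ≤ Metric.infDist x (frontier Δ)}.Nonempty) :
    ∃ Cd > (0 : ℝ), ∀ f : EuclideanSpace ℝ (Fin n) → ℝ,
      ConcaveOn ℝ Δ f → (∀ y ∈ Δ, f y ≤ 0) →
      IntegrableOn (fun y => (-f y) * P y) Δ →
      (∀ x ∈ {x ∈ Δ | d ≤ Metric.infDist x (frontier Δ)},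
        f x ≤ 0 ∧ -(Cd * ∫ y in Δ, (-f y) * P y) ≤ f x) ∧
      (∀ x ∈ {x ∈ Δ | d ≤ Metric.infDist x (frontier Δ)},
        ∀ y ∈ {x ∈ Δ | d ≤ Metric.infDist x (frontier Δ)},
          |f x - f y| ≤ Cd * (∫ z in Δ, (-f z) * P z) * ‖x - y‖) := by
  have hcl : IsClosed Δ := hΔcomp.isClosed
  have hP0 : ∀ y ∈ Δ, 0 ≤ P y := by
    intro y hy
    have hsub : Δ ⊆ closure (interior Δ) :=
      (hΔconv.closure_interior_eq_closure_of_nonempty_interior hΔint).symm ▸ subset_closure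
    have hcont := hPcont y hy
    have : (nhdsWithin y (interior Δ)).NeBot := mem_closure_iff_nhdsWithin_neBot.1 (hsub hy)
    exact ge_of_tendsto (hcont.mono_left (nhdsWithin_mono y interior_subset))
      (eventually_nhdsWithin_of_forall fun z hz => (hPpos z hz).le)
  obtain ⟨m, hm, hPm⟩ : ∃ m > 0, ∀ y ∈ {x ∈ Δ | d / 4 ≤ Metric.infDist x (frontier Δ)},
      m ≤ P y := by
    have hKcomp : IsCompact {x ∈ Δ | d / 4 ≤ Metric.infDist x (frontier Δ)} :=
      hΔcomp.inter_right (isClosed_le continuous_const (Metric.continuous_infDist_pt _))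
    obtain ⟨x₀, hx₀, hmin⟩ := hKcomp.exists_isMinOn
      (hne.mono fun x hx => ⟨hx.1, by linarith [hx.2]⟩) (hPcont.mono fun x hx => hx.1)
    exact ⟨P x₀, hPpos x₀ (hcl.ball_subset_interior_of_le_infDist_frontier hx₀.1 hx₀.2
      (Metric.mem_ball_self (by positivity))), fun y hy => hmin hy⟩
  set V : ℝ := volume.real (Metric.closedBall (0 : EuclideanSpace ℝ (Fin n)) (d / 4)) with hV
  have hV0 : 0 < V :=
    ENNReal.toReal_pos (Metric.measure_closedBall_pos _ _ (by positivity)).ne'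
      measure_closedBall_lt_top.ne
  refine ⟨(m * V)⁻¹ * (1 + 8 / d), by positivity, fun f hf hf0 hfi => ?_⟩
  set I : ℝ := ∫ y in Δ, (-f y) * P y
  have hI0 : 0 ≤ I := setIntegral_nonneg hcl.measurableSet fun y hy =>
    mul_nonneg (neg_nonneg.2 (hf0 y hy)) (hP0 y hy)
  have hbound : ∀ x ∈ {x ∈ Δ | d / 2 ≤ Metric.infDist x (frontier Δ)}, -f x ≤ (m * V)⁻¹ * I := by
    intro x hx
    have hquarter : ∀ y ∈ Metric.closedBall x (d / 4),
        y ∈ {x ∈ Δ | d / 4 ≤ Metric.infDist x (frontier Δ)} := by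
      intro y hy
      have h := hcl.mem_and_le_infDist_frontier_of_mem_closedBall hx (by linarith) hy
      exact ⟨h.1, by linarith [h.2]⟩
    have h := hf.neg.mul_measureReal_closedBall_mul_le_setIntegral_mul (μ := volume) (P := P)
      (x := x) (r := d / 4) hcl.measurableSet (fun y hy => neg_nonneg.2 (hf0 y hy)) hP0 hfi hm.le
      ((Metric.closedBall_subset_ball (by linarith)).trans
        (hcl.ball_subset_interior_of_le_infDist_frontier hx.1 hx.2))
      (fun y hy => hPm y (hquarter y hy))
    rw [Measure.addHaar_real_closedBall_center, ← hV] at h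
    rw [inv_mul_eq_div, le_div_iff₀ (by positivity), mul_comm]
    exact h
  have hsub : ∀ x ∈ {x ∈ Δ | d ≤ Metric.infDist x (frontier Δ)},
      x ∈ {x ∈ Δ | d / 2 ≤ Metric.infDist x (frontier Δ)} :=
    fun x hx => ⟨hx.1, by linarith [hx.2]⟩
  have hAI : 0 ≤ (m * V)⁻¹ * I := by positivity
  refine ⟨fun x hx => ⟨hf0 x hx.1, ?_⟩, fun x hx y hy => ?_⟩
  · have h := hbound x (hsub x hx)
    have h8 : 0 ≤ (m * V)⁻¹ * I * (8 / d) := by positivity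
    linarith
  suffices h : |f x - f y| ≤ (m * V)⁻¹ * I * (8 / d) * ‖x - y‖ by
    have hxy : 0 ≤ (m * V)⁻¹ * I * ‖x - y‖ := by positivity
    linarith
  rcases lt_or_ge (dist y x) (d / 4) with hlt | hge
  · have hball : Metric.ball x (d / 2) ⊆ Δ :=
      (Metric.ball_subset_ball (by linarith)).trans
        ((hcl.ball_subset_interior_of_le_infDist_frontier hx.1 hx.2).trans interior_subset)
    have hlip := (hf.subset hball (convex_ball x _)).lipschitzOnWith_of_abs_le
      (ε := d / 4) (M := (m * V)⁻¹ * I) (by positivity) (fun a ha => by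
        have h := hcl.mem_and_le_infDist_frontier_of_mem_closedBall hx (by linarith)
          (Metric.mem_closedBall.2 ha.le)
        rw [abs_of_nonpos (hf0 a h.1)]
        exact hbound a ⟨h.1, by linarith [h.2]⟩)
    have h := hlip.dist_le_mul x (Metric.mem_ball_self (by linarith)) y
      (Metric.mem_ball.2 (by linarith))
    rw [Real.coe_toNNReal _ (by positivity), Real.dist_eq, dist_eq_norm] at h
    convert h using 2
    ring
  · have hfx := hbound x (hsub x hx)
    have hfy := hbound y (hsub y hy)
    have hfx0 := hf0 x hx.1
    have hfy0 := hf0 y hy.1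
    rw [dist_comm, dist_eq_norm] at hge
    have hone : 1 ≤ 8 / d * ‖x - y‖ := by
      rw [div_mul_eq_mul_div, le_div_iff₀ hd]
      linarith
    calc |f x - f y| ≤ (m * V)⁻¹ * I := abs_sub_le_iff.2 ⟨by linarith, by linarith⟩
      _ ≤ (m * V)⁻¹ * I * (8 / d * ‖x - y‖) := le_mul_of_one_le_right hAI hone
      _ = (m * V)⁻¹ * I * (8 / d) * ‖x - y‖ := (mul_assoc _ _ _).symm
end

section
/- Let Δ ⊂ ℝⁿ be a compact convex set with nonempty interior and let V ⊆ ℝⁿ be a closed convex cone. Let g : Δ → ℝ be a piecewise linear concave function with slopes in V, i.e. g(x) = min_{1 ≤ j ≤ m} ( ⟨v_j, x⟩ + c_j ) for finitely many v_j ∈ V and c_j ∈ ℝ. Then g can be uniformly approximated on Δ by smooth concave functions with slopes in V: for every ε > 0 there exists a concave function f, smooth on an open neighborhood of Δ, with ∇f(x) ∈ V for every x ∈ Δ, such that sup_{x ∈ Δ} |f(x) − g(x)| < ε. -/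
open RealInnerProductSpace

/-- The log-sum-exp function `z ↦ log (∑ i, exp (z i))`. -/
noncomputable def logSumExp {ι : Type*} [Fintype ι] (z : ι → ℝ) : ℝ :=
  Real.log (∑ i, Real.exp (z i))

section LogSumExp

variable {ι : Type*} [Fintype ι] [Nonempty ι]

lemma sum_exp_pos (z : ι → ℝ) : 0 < ∑ i, Real.exp (z i) :=
  Finset.sum_pos (fun _ _ => Real.exp_pos _) Finset.univ_nonempty

lemma sum_exp_sub_logSumExp (z : ι → ℝ) : ∑ i, Real.exp (z i - logSumExp z) = 1 := by
  simp only [Real.exp_sub, logSumExp, Real.exp_log (sum_exp_pos z), ← Finset.sum_div]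
  exact div_self (sum_exp_pos z).ne'

lemma le_logSumExp (z : ι → ℝ) (i : ι) : z i ≤ logSumExp z := by
  rw [logSumExp, Real.le_log_iff_exp_le (sum_exp_pos z)]
  exact Finset.single_le_sum (f := fun i => Real.exp (z i)) (fun _ _ => (Real.exp_pos _).le)
    (Finset.mem_univ i)

lemma logSumExp_le {z : ι → ℝ} {M : ℝ} (h : ∀ i, z i ≤ M) :
    logSumExp z ≤ Real.log (Fintype.card ι) + M := by
  have hcard : (0 : ℝ) < Fintype.card ι := by exact_mod_cast Fintype.card_pos
  rw [logSumExp, Real.log_le_iff_le_exp (sum_exp_pos z), Real.exp_add, Real.exp_log hcard]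
  calc ∑ i, Real.exp (z i) ≤ ∑ _i : ι, Real.exp M :=
        Finset.sum_le_sum fun i _ => Real.exp_le_exp.2 (h i)
    _ = Fintype.card ι * Real.exp M := by simp

lemma convexOn_logSumExp : ConvexOn ℝ Set.univ (logSumExp : (ι → ℝ) → ℝ) := by
  refine ⟨convex_univ, fun y _ z _ a b ha hb hab => ?_⟩
  set s := a • logSumExp y + b • logSumExp z
  suffices h : ∑ i, Real.exp ((a • y + b • z) i) ≤ Real.exp s by
    rwa [logSumExp, Real.log_le_iff_le_exp (sum_exp_pos _)]
  have key : ∀ i, Real.exp ((a • y + b • z) i - s) ≤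
      a * Real.exp (y i - logSumExp y) + b * Real.exp (z i - logSumExp z) := by
    intro i
    have h := convexOn_exp.2 (Set.mem_univ (y i - logSumExp y))
      (Set.mem_univ (z i - logSumExp z)) ha hb hab
    have hs : (a • y + b • z) i - s =
        a • (y i - logSumExp y) + b • (z i - logSumExp z) := by
      simp only [s, Pi.add_apply, Pi.smul_apply, smul_eq_mul]
      ring
    rw [hs]
    exact h
  have h := Finset.sum_le_sum fun i (_ : i ∈ Finset.univ) => key i
  rw [Finset.sum_add_distrib, ← Finset.mul_sum, ← Finset.mul_sum, sum_exp_sub_logSumExp,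
    sum_exp_sub_logSumExp, mul_one, mul_one, hab] at h
  simpa only [Real.exp_sub, ← Finset.sum_div, div_le_one (Real.exp_pos s)] using h

lemma contDiff_logSumExp {k : WithTop ℕ∞} : ContDiff ℝ k (logSumExp : (ι → ℝ) → ℝ) := by
  unfold logSumExp
  exact ContDiff.log (by fun_prop) fun z => (sum_exp_pos z).ne'

lemma hasGradientAt_logSumExp_comp {E : Type*} [NormedAddCommGroup E] [InnerProductSpace ℝ E]
    [CompleteSpace E] {l : ι → E → ℝ} {w : ι → E} {x : E}
    (hl : ∀ i, HasGradientAt (l i) (w i) x) :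
    HasGradientAt (fun y => logSumExp fun i => l i y)
      (∑ i, Real.exp (l i x - logSumExp fun i => l i x) • w i) x := by
  have h := (HasFDerivAt.fun_sum fun i (_ : i ∈ Finset.univ) => (hl i).hasFDerivAt.exp).log
    (sum_exp_pos fun i => l i x).ne'
  rw [hasGradientAt_iff_hasFDerivAt]
  have hsum :
      InnerProductSpace.toDual ℝ E (∑ i, Real.exp (l i x - logSumExp fun i => l i x) • w i) =
        (∑ i, Real.exp (l i x))⁻¹ • ∑ i, Real.exp (l i x) • InnerProductSpace.toDual ℝ E (w i) := by
    rw [map_sum, Finset.smul_sum]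
    refine Finset.sum_congr rfl fun i _ => ?_
    rw [map_smul, smul_smul, Real.exp_sub, logSumExp,
      Real.exp_log (sum_exp_pos fun i => l i x), div_eq_inv_mul]
  rw [hsum]
  exact h

end LogSumExp

/-- Smooth approximation of piecewise linear concave functions with slopes in a cone.
Let `Δ ⊂ ℝⁿ` be a compact convex set with nonempty interior, `V` a closed convex cone,
and `g(x) = min_j (⟨v_j, x⟩ + c_j)` a piecewise linear concave function with slopes
`v_j ∈ V`.  Then for every `ε > 0` there is a concave function `f`, smooth on an open
neighborhood of `Δ`, with `∇f(x) ∈ V` on `Δ`, such that `sup_Δ |f − g| < ε`. -/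
theorem smooth_approximation_piecewise_linear_concave {n : ℕ}
    (Δ V : Set (EuclideanSpace ℝ (Fin n)))
    (hΔconv : Convex ℝ Δ) (hΔcomp : IsCompact Δ) (hΔint : (interior Δ).Nonempty)
    (hVconv : Convex ℝ V) (hVclosed : IsClosed V)
    (hVcone : ∀ c : ℝ, 0 ≤ c → ∀ v ∈ V, c • v ∈ V)
    (m : ℕ) (hm : 0 < m)
    (v : Fin m → EuclideanSpace ℝ (Fin n)) (hv : ∀ j, v j ∈ V)
    (c : Fin m → ℝ)
    (g : EuclideanSpace ℝ (Fin n) → ℝ)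
    (hg : ∀ x, g x = ⨅ j, (⟪v j, x⟫ + c j)) :
    ∀ ε > (0 : ℝ), ∃ (f : EuclideanSpace ℝ (Fin n) → ℝ)
      (U : Set (EuclideanSpace ℝ (Fin n))),
      IsOpen U ∧ Δ ⊆ U ∧ ConcaveOn ℝ U f ∧ ContDiffOn ℝ (⊤ : ℕ∞) f U ∧
      (∀ x ∈ Δ, gradient f x ∈ V) ∧ ∀ x ∈ Δ, |f x - g x| < ε := by
  intro ε hε
  have : Nonempty (Fin m) := ⟨⟨0, hm⟩⟩
  have hlog : 0 ≤ Real.log m := Real.log_natCast_nonneg m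
  set δ : ℝ := ε / (Real.log m + 1)
  have hδ : 0 < δ := by positivity
  have hδε : δ * Real.log m < ε := by
    have : δ * (Real.log m + 1) = ε := div_mul_cancel₀ _ (by positivity)
    linarith
  let l : Fin m → EuclideanSpace ℝ (Fin n) → ℝ := fun j x => -δ⁻¹ * (⟪v j, x⟫ + c j)
  have hl : ∀ j x, ⟪v j, x⟫ + c j = -δ * l j x := by
    intro j x
    simp only [l]
    field_simp
  refine ⟨fun x => -δ * logSumExp fun j => l j x, Set.univ, isOpen_univ, Set.subset_univ _,
    ⟨convex_univ, ?_⟩, ?_, ?_, ?_⟩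
  · intro x _ y _ a b ha hb hab
    have h := convexOn_logSumExp.2 (Set.mem_univ fun j => l j x) (Set.mem_univ fun j => l j y)
      ha hb hab
    have hcomb : (fun j => l j (a • x + b • y)) = a • (fun j => l j x) + b • fun j => l j y := by
      ext j
      simp only [l, inner_add_right, inner_smul_right, Pi.add_apply, Pi.smul_apply, smul_eq_mul]
      linear_combination δ⁻¹ * c j * hab
    simp only [hcomb, smul_eq_mul] at h ⊢
    linarith [mul_le_mul_of_nonneg_left h hδ.le]
  · refine ContDiff.contDiffOn (contDiff_const.mul (contDiff_logSumExp.comp ?_))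
    exact contDiff_pi.2 fun j =>
      contDiff_const.mul ((contDiff_const.inner ℝ contDiff_id).add contDiff_const)
  · intro x _
    have hgrad : ∀ j, HasGradientAt (l j) (-δ⁻¹ • v j) x := by
      intro j
      have h := (((innerSL ℝ (v j)).hasFDerivAt (x := x)).add_const (c j)).const_mul (-δ⁻¹)
      rw [hasGradientAt_iff_hasFDerivAt, map_smul]
      exact h
    have h := (hasGradientAt_logSumExp_comp hgrad).hasFDerivAt.const_mul (-δ)
    rw [← map_smul, ← hasGradientAt_iff_hasFDerivAt] at h
    rw [h.gradient, Finset.smul_sum]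
    have hcancel : ∀ (p : ℝ) j, -δ • p • -δ⁻¹ • v j = p • v j := by
      intro p j
      rw [smul_smul, smul_smul]
      congr 1
      field_simp
    simp only [hcancel]
    exact hVconv.sum_mem (fun j _ => (Real.exp_pos _).le) (sum_exp_sub_logSumExp _)
      fun j _ => hv j
  · intro x _
    have hlower : ∀ j, g x ≤ -δ * l j x := by
      intro j
      rw [hg, ← hl]
      exact ciInf_le (Set.finite_range _).bddBelow j
    have hupper : -δ * logSumExp (fun j => l j x) ≤ g x := by
      rw [hg]
      refine le_ciInf fun j => ?_
      rw [hl]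
      linarith [mul_le_mul_of_nonneg_left (le_logSumExp (fun j => l j x) j) hδ.le]
    have hbound : logSumExp (fun j => l j x) ≤ Real.log m + -g x / δ := by
      have h := logSumExp_le (z := fun j => l j x) (M := -g x / δ) fun j => by
        rw [le_div_iff₀ hδ]
        linarith [hlower j]
      rwa [Fintype.card_fin] at h
    have h := mul_le_mul_of_nonneg_left hbound hδ.le
    rw [mul_add, mul_div_cancel₀ _ hδ.ne'] at h
    rw [abs_lt]
    constructor <;> linarith
end
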